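/- arXiv:2101.11663 — 3 statements merged into one kernel-verified Lean document; each statement's English description precedes it below -/
import Mathlib

section
/- Let (σ_ij) and (1/μ)_ij (with entries 1/μ_ij for i ≠ j and 0 on the diagonal) be symmetric N×N real matrices with zero diagonal, both negative definite on (1,…,1)^⊥, i.e. v·σv < 0 and v·(1/μ)v < 0 for all nonzero v ∈ ℝ^N with Σᵢ vᵢ = 0. Let J be the N×N matrix with entries J_ij = δ_ij − 1/N, let s_1,…,s_{N−1} be the nonzero eigenvalues of JσJ and m_1,…,m_{N−1} the nonzero eigenvalues of J(1/μ)J. If γ > β > 0 satisfy γ > (min_i s_i)/(max_i m_i) and β < (max_i s_i)/(min_i m_i), then the matrices 𝔸 = (−a_ij) and 𝔹 = (−b_ij) are positive definite on (1,…,1)^⊥, i.e. v·𝔸v > 0 and v·𝔹v > 0 for all nonzero v ∈ ℝ^N with Σᵢ vᵢ = 0. -/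
open Real
open Matrix in
lemma spec_aux {n : Type*} [Fintype n] [DecidableEq n] (H : Matrix n n ℝ) (hH : H.IsHermitian) :
    ∃ (l : n → ℝ) (u : n → n → ℝ), (∀ k, H *ᵥ u k = l k • u k) ∧ (∀ k, u k ≠ 0) ∧
      ∀ x y : n → ℝ, x ⬝ᵥ y = ∑ k, (x ⬝ᵥ u k) * (u k ⬝ᵥ y) := by
  refine ⟨hH.eigenvalues, fun k => (hH.eigenvectorBasis k).ofLp, ?_, ?_, ?_⟩
  · intro k
    exact hH.mulVec_eigenvectorBasis k
  · intro k h
    have h1 := hH.eigenvectorBasis.orthonormal.ne_zero k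
    apply h1
    ext i
    exact congrFun h i
  · intro x y
    have h := hH.eigenvectorBasis.sum_inner_mul_inner (WithLp.toLp 2 x) (WithLp.toLp 2 y)
    simp only [EuclideanSpace.inner_eq_star_dotProduct, star_trivial] at h
    rw [dotProduct_comm x y, ← h]
    refine Finset.sum_congr rfl fun k _ => ?_
    rw [dotProduct_comm x, dotProduct_comm _ y]

open Matrix in
lemma key_aux (N : ℕ) (hN : 2 ≤ N) (M J : Matrix (Fin N) (Fin N) ℝ)
    (hsymm : ∀ i j, M i j = M j i)
    (hneg : ∀ v : Fin N → ℝ, v ≠ 0 → ∑ i, v i = 0 → ∑ i, ∑ j, v i * M i j * v j < 0)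
    (hJ : ∀ i j, J i j = (if i = j then (1 : ℝ) else 0) - 1 / N)
    (s : Fin (N - 1) → ℝ) (hs0 : ∀ i, s i ≠ 0)
    (hsEig : ∀ i, Module.End.HasEigenvalue (Matrix.toLin' (J * M * J)) (s i))
    (hsAll : ∀ x : ℝ, x ≠ 0 → Module.End.HasEigenvalue (Matrix.toLin' (J * M * J)) x →
      ∃ i, s i = x) :
    (∀ i, s i < 0) ∧ ∀ v : Fin N → ℝ, ∑ i, v i = 0 →
      (⨅ i, s i) * (v ⬝ᵥ v) ≤ ∑ i, ∑ j, v i * M i j * v j ∧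
      ∑ i, ∑ j, v i * M i j * v j ≤ (⨆ i, s i) * (v ⬝ᵥ v) := by
  have hN0 : (N : ℝ) ≠ 0 := by positivity
  have hq : ∀ v : Fin N → ℝ, ∑ i, ∑ j, v i * M i j * v j = v ⬝ᵥ (M *ᵥ v) := by
    intro v
    simp only [dotProduct, mulVec, Finset.mul_sum, mul_assoc]
  simp only [hq] at hneg ⊢
  have hJv : ∀ v : Fin N → ℝ, ∀ i, (J *ᵥ v) i = v i - (∑ j, v j) / N := by
    intro v i
    simp only [mulVec, dotProduct, hJ, sub_mul, Finset.sum_sub_distrib, ite_mul, one_mul, zero_mul,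
      Finset.sum_ite_eq, Finset.mem_univ, if_true, ← Finset.mul_sum]
    ring
  have hJsum : ∀ v : Fin N → ℝ, ∑ i, (J *ᵥ v) i = 0 := by
    intro v
    simp only [hJv, Finset.sum_sub_distrib, Finset.sum_const, Finset.card_univ, Fintype.card_fin,
      nsmul_eq_mul]
    field_simp
    ring
  have hJT : Jᵀ = J := by
    ext i j
    simp only [transpose_apply, hJ, eq_comm]
  have hMT : Mᵀ = M := by
    ext i j
    exact hsymm j i
  have hH : (J * M * J)ᵀ = J * M * J := by
    simp only [transpose_mul, hJT, hMT, Matrix.mul_assoc]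
  have hHq : ∀ x y : Fin N → ℝ, x ⬝ᵥ ((J * M * J) *ᵥ y) = (J *ᵥ x) ⬝ᵥ (M *ᵥ (J *ᵥ y)) := by
    intro x y
    rw [← mulVec_mulVec, ← mulVec_mulVec, dotProduct_mulVec, ← mulVec_transpose, hJT]
  constructor
  · intro i
    obtain ⟨x, hx⟩ := (hsEig i).exists_hasEigenvector
    have hx1 : (J * M * J) *ᵥ x = s i • x := hx.apply_eq_smul
    have hx0 : x ≠ 0 := hx.2
    have h1 := hHq x x
    rw [hx1, dotProduct_smul, smul_eq_mul] at h1
    have h2 : 0 < x ⬝ᵥ x := by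
      rcases (dotProduct_self_star_nonneg x).lt_or_eq with h | h
      · simpa using h
      · exact absurd (dotProduct_self_eq_zero.1 (by simpa using h.symm)) hx0
    have h3 : (J *ᵥ x) ⬝ᵥ (M *ᵥ (J *ᵥ x)) ≤ 0 := by
      by_cases h : J *ᵥ x = 0
      · simp [h]
      · exact (hneg _ h (hJsum x)).le
    have h4 : s i ≤ 0 := by
      by_contra hc
      push Not at hc
      have := mul_pos hc h2
      linarith
    exact lt_of_le_of_ne h4 (hs0 i)
  · intro v hv
    have hJvv : J *ᵥ v = v := by
      ext i
      simp [hJv, hv]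
    obtain ⟨l, u, h1, h2, h3⟩ := spec_aux (J * M * J) (by
      rw [IsHermitian, conjTranspose_eq_transpose_of_trivial, hH])
    have e1 : v ⬝ᵥ (M *ᵥ v) = ∑ k, l k * (v ⬝ᵥ u k) ^ 2 := by
      have := hHq v v
      rw [hJvv] at this
      rw [← this, h3]
      refine Finset.sum_congr rfl fun k _ => ?_
      rw [dotProduct_mulVec (u k), ← mulVec_transpose, hH, h1, smul_dotProduct, smul_eq_mul,
        dotProduct_comm (u k) v]
      ring
    have e2 : v ⬝ᵥ v = ∑ k, (v ⬝ᵥ u k) ^ 2 := by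
      rw [h3]
      refine Finset.sum_congr rfl fun k _ => ?_
      rw [dotProduct_comm (u k) v]
      ring
    have h4 : ∀ k, v ⬝ᵥ u k = 0 ∨ ∃ i, s i = l k := by
      intro k
      by_cases hl : l k = 0
      · left
        have h5 := hHq (u k) (u k)
        rw [h1, hl, zero_smul, dotProduct_zero] at h5
        have h6 : J *ᵥ u k = 0 := by
          by_contra h
          have := hneg _ h (hJsum _)
          linarith
        have h7 : ∀ i, u k i = (∑ j, u k j) / N := by
          intro i
          have := congrFun h6 i
          rw [hJv] at this
          simp only [Pi.zero_apply] at this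
          linarith
        calc v ⬝ᵥ u k = ∑ i, v i * ((∑ j, u k j) / N) :=
              Finset.sum_congr rfl fun i _ => by rw [← h7 i]
          _ = 0 := by rw [← Finset.sum_mul, hv, zero_mul]
      · right
        apply hsAll _ hl
        apply Module.End.hasEigenvalue_of_hasEigenvector (x := u k)
        refine ⟨?_, h2 k⟩
        rw [Module.End.mem_eigenspace_iff]
        exact h1 k
    rw [e1, e2, Finset.mul_sum, Finset.mul_sum]
    constructor
    · refine Finset.sum_le_sum fun k _ => ?_
      rcases h4 k with h | ⟨i, h⟩
      · simp [h]
      · rw [← h]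
        exact mul_le_mul_of_nonneg_right (ciInf_le (Set.finite_range s).bddBelow i) (sq_nonneg _)
    · refine Finset.sum_le_sum fun k _ => ?_
      rcases h4 k with h | ⟨i, h⟩
      · simp [h]
      · rw [← h]
        exact mul_le_mul_of_nonneg_right (le_ciSup (Set.finite_range s).bddAbove i) (sq_nonneg _)

/-- Salvador–Esedoğlu: if `σ` and `1/μ` are negative definite on `(1,…,1)^⊥`
and `γ > (min s_i)/(max m_i)`, `β < (max s_i)/(min m_i)` (with `s_i`, `m_i` the nonzero
eigenvalues of `JσJ` resp. `J(1/μ)J`), then `𝔸 = (−a_ij)` and `𝔹 = (−b_ij)` are positive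
definite on `(1,…,1)^⊥`. -/
theorem stmt_2 (N : ℕ) (hN : 2 ≤ N)
    (σ μ : Matrix (Fin N) (Fin N) ℝ)
    (hσsymm : ∀ i j, σ i j = σ j i) (hμsymm : ∀ i j, μ i j = μ j i)
    (hσdiag : ∀ i, σ i i = 0) (hμdiag : ∀ i, μ i i = 0)
    (hμpos : ∀ i j, i ≠ j → 0 < μ i j)
    (μinv : Matrix (Fin N) (Fin N) ℝ)
    (hμinv : ∀ i j, μinv i j = if i = j then 0 else 1 / μ i j)
    (hσneg : ∀ v : Fin N → ℝ, v ≠ 0 → ∑ i, v i = 0 → ∑ i, ∑ j, v i * σ i j * v j < 0)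
    (hμneg : ∀ v : Fin N → ℝ, v ≠ 0 → ∑ i, v i = 0 →
      ∑ i, ∑ j, v i * μinv i j * v j < 0)
    (J : Matrix (Fin N) (Fin N) ℝ)
    (hJ : ∀ i j, J i j = (if i = j then (1 : ℝ) else 0) - 1 / N)
    (s m : Fin (N - 1) → ℝ)
    (hs0 : ∀ i, s i ≠ 0)
    (hsEig : ∀ i, Module.End.HasEigenvalue (Matrix.toLin' (J * σ * J)) (s i))
    (hsAll : ∀ x : ℝ, x ≠ 0 → Module.End.HasEigenvalue (Matrix.toLin' (J * σ * J)) x →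
      ∃ i, s i = x)
    (hm0 : ∀ i, m i ≠ 0)
    (hmEig : ∀ i, Module.End.HasEigenvalue (Matrix.toLin' (J * μinv * J)) (m i))
    (hmAll : ∀ x : ℝ, x ≠ 0 → Module.End.HasEigenvalue (Matrix.toLin' (J * μinv * J)) x →
      ∃ i, m i = x)
    (γ β : ℝ) (hβ0 : 0 < β) (hβγ : β < γ)
    (hγ : (⨅ i, s i) / (⨆ i, m i) < γ)
    (hβ : β < (⨆ i, s i) / (⨅ i, m i))
    (a b : Fin N → Fin N → ℝ)
    (ha : ∀ i j, i ≠ j →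
      a i j = Real.sqrt π * Real.sqrt γ / (γ - β) * (σ i j - β / μ i j))
    (hb : ∀ i j, i ≠ j →
      b i j = Real.sqrt π * Real.sqrt β / (γ - β) * (γ / μ i j - σ i j))
    (hadiag : ∀ i, a i i = 0) (hbdiag : ∀ i, b i i = 0) :
    ∀ v : Fin N → ℝ, v ≠ 0 → ∑ i, v i = 0 →
      0 < ∑ i, ∑ j, v i * (-(a i j)) * v j ∧ 0 < ∑ i, ∑ j, v i * (-(b i j)) * v j := by
  obtain ⟨hs, hsq⟩ := key_aux N hN σ J hσsymm hσneg hJ s hs0 hsEig hsAll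
  have hμis : ∀ i j, μinv i j = μinv j i := by
    intro i j
    rw [hμinv, hμinv, hμsymm i j]
    simp only [eq_comm]
  obtain ⟨hm, hmq⟩ := key_aux N hN μinv J hμis hμneg hJ m hm0 hmEig hmAll
  intro v hv0 hv
  obtain ⟨s1, s2⟩ := hsq v hv
  obtain ⟨m1, m2⟩ := hmq v hv
  haveI : Nonempty (Fin (N - 1)) := ⟨⟨0, by omega⟩⟩
  have hMmax : (⨆ i, m i) < 0 := by
    obtain ⟨i, hi⟩ := exists_eq_ciSup_of_finite (f := m)
    rw [← hi]
    exact hm i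
  have hMmin : (⨅ i, m i) < 0 := by
    obtain ⟨i, hi⟩ := exists_eq_ciInf_of_finite (f := m)
    rw [← hi]
    exact hm i
  rw [div_lt_iff_of_neg hMmax] at hγ
  rw [lt_div_iff_of_neg hMmin] at hβ
  have hvv : 0 < dotProduct v v := by
    rcases (dotProduct_self_star_nonneg v).lt_or_eq with h | h
    · simpa using h
    · exact absurd (dotProduct_self_eq_zero.1 (by simpa using h.symm)) hv0
  have hπ : 0 < Real.sqrt π := Real.sqrt_pos.2 Real.pi_pos
  have hγ0 : 0 < γ := hβ0.trans hβγ
  have hA : 0 < Real.sqrt π * Real.sqrt γ / (γ - β) :=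
    div_pos (mul_pos hπ (Real.sqrt_pos.2 hγ0)) (sub_pos.2 hβγ)
  have hB : 0 < Real.sqrt π * Real.sqrt β / (γ - β) :=
    div_pos (mul_pos hπ (Real.sqrt_pos.2 hβ0)) (sub_pos.2 hβγ)
  have ea : ∑ i, ∑ j, v i * (-(a i j)) * v j = Real.sqrt π * Real.sqrt γ / (γ - β) *
      (β * (∑ i, ∑ j, v i * μinv i j * v j) - ∑ i, ∑ j, v i * σ i j * v j) := by
    simp only [Finset.mul_sum, ← Finset.sum_sub_distrib]
    refine Finset.sum_congr rfl fun i _ => Finset.sum_congr rfl fun j _ => ?_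
    by_cases h : i = j
    · subst h
      simp [hμinv, hadiag, hσdiag]
    · rw [ha i j h, hμinv, if_neg h]
      ring
  have eb : ∑ i, ∑ j, v i * (-(b i j)) * v j = Real.sqrt π * Real.sqrt β / (γ - β) *
      ((∑ i, ∑ j, v i * σ i j * v j) - γ * (∑ i, ∑ j, v i * μinv i j * v j)) := by
    simp only [Finset.mul_sum, ← Finset.sum_sub_distrib]
    refine Finset.sum_congr rfl fun i _ => Finset.sum_congr rfl fun j _ => ?_
    by_cases h : i = j
    · subst h
      simp [hμinv, hbdiag, hσdiag]
    · rw [hb i j h, hμinv, if_neg h]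
      ring
  rw [ea, eb]
  constructor
  · apply mul_pos hA
    have h1 := mul_le_mul_of_nonneg_left m1 hβ0.le
    have h2 := mul_lt_mul_of_pos_right hβ hvv
    linarith
  · apply mul_pos hB
    have h1 := mul_le_mul_of_nonneg_left m2 hγ0.le
    have h2 := mul_lt_mul_of_pos_right hγ hvv
    linarith
end

section
/- Let d, N ∈ ℕ, γ > β > 0, h > 0, and let (a_ij), (b_ij) be symmetric N×N real matrices with zero diagonal; set 𝔸 = (−a_ij) and 𝔹 = (−b_ij). Let w : ℝ^d → ℝ^N be bounded, measurable and ℤ^d-periodic. Then −2√h · Σ_{i,j=1}^N ∫_{[0,1)^d} w_i(x)·(K^h_ij * w_j)(x) dx = 2√h · ∫_{[0,1)^d} [ (G_γ^{h/2}*w)(x)·𝔸(G_γ^{h/2}*w)(x) + (G_β^{h/2}*w)(x)·𝔹(G_β^{h/2}*w)(x) ] dx, where the convolutions G^{h/2}_γ*w and G^{h/2}_β*w are taken componentwise. -/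
open Real MeasureTheory Filter Topology

/-- The `d`-dimensional heat kernel `G_t(z) = (4πt)^{-d/2} exp(-|z|²/(4t))`. -/
noncomputable def heatK (d : ℕ) (t : ℝ) (z : Fin d → ℝ) : ℝ :=
  (4 * Real.pi * t) ^ (-(d : ℝ) / 2) * Real.exp (-(∑ i, z i ^ 2) / (4 * t))

/-- The rescaled kernel `K^h_ij(z) = h^{-d/2}·(a_ij G_γ + b_ij G_β)(z/√h)`. -/
noncomputable def Khij (d : ℕ) (γ β aij bij h : ℝ) (z : Fin d → ℝ) : ℝ :=
  h ^ (-(d : ℝ) / 2) *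
    (aij * heatK d γ ((Real.sqrt h)⁻¹ • z) + bij * heatK d β ((Real.sqrt h)⁻¹ • z))

/-- Convolution `(K*u)(x) = ∫ K(z) u(x−z) dz`. -/
noncomputable def conv {d : ℕ} (K : (Fin d → ℝ) → ℝ) (u : (Fin d → ℝ) → ℝ)
    (x : Fin d → ℝ) : ℝ :=
  ∫ z, K z * u (x - z)

/-- The unit box `[0,1)^d`. -/
def unitBox (d : ℕ) : Set (Fin d → ℝ) := Set.univ.pi fun _ => Set.Ico (0 : ℝ) 1

/-- `ℤ^d`-periodicity. -/
def ZPeriodic {d : ℕ} {α : Type*} (u : (Fin d → ℝ) → α) : Prop :=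
  ∀ (x : Fin d → ℝ) (k : Fin d → ℤ), u (x + fun i => (k i : ℝ)) = u x

/-- Membership in `ℳ`: measurable `ℤ^d`-periodic functions with values in `[0,1]^N`
summing to `1` a.e. -/
def memM {d N : ℕ} (u : (Fin d → ℝ) → Fin N → ℝ) : Prop :=
  Measurable u ∧ ZPeriodic u ∧ (∀ x i, u x i ∈ Set.Icc (0 : ℝ) 1) ∧
    ∀ᵐ x ∂(volume : Measure (Fin d → ℝ)), ∑ i, u x i = 1

/-- Membership in `𝒜`: elements of `ℳ` with values in `{0,1}^N`. -/
def memA {d N : ℕ} (u : (Fin d → ℝ) → Fin N → ℝ) : Prop :=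
  memM u ∧ ∀ x i, u x i = 0 ∨ u x i = 1

/-- The approximate energy `E_h(u) = h^{-1/2} Σ_{i,j} ∫_{[0,1)^d} u_i K^h_ij * u_j dx`. -/
noncomputable def Eh {d N : ℕ} (γ β : ℝ) (a b : Fin N → Fin N → ℝ) (h : ℝ)
    (u : (Fin d → ℝ) → Fin N → ℝ) : ℝ :=
  (Real.sqrt h)⁻¹ * ∑ i, ∑ j, ∫ x in unitBox d,
    u x i * conv (Khij d γ β (a i j) (b i j) h) (fun y => u y j) x

/-- The squared distance
`d_h(u,v)² = -2√h Σ_{i,j} ∫_{[0,1)^d} (u_i-v_i) K^h_ij * (u_j-v_j) dx`. -/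
noncomputable def dsq {d N : ℕ} (γ β : ℝ) (a b : Fin N → Fin N → ℝ) (h : ℝ)
    (u v : (Fin d → ℝ) → Fin N → ℝ) : ℝ :=
  -2 * Real.sqrt h * ∑ i, ∑ j, ∫ x in unitBox d,
    (u x i - v x i) * conv (Khij d γ β (a i j) (b i j) h) (fun y => u y j - v y j) x

structure BMP {d : ℕ} (u : (Fin d → ℝ) → ℝ) : Prop where
  meas : Measurable u
  bdd : ∃ C : ℝ, 0 ≤ C ∧ ∀ x, |u x| ≤ C
  per : ZPeriodic u

lemma gauss_eq_prod {d : ℕ} (b : ℝ) (z : Fin d → ℝ) :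
    Real.exp (-b * ∑ i, z i ^ 2) = ∏ i, Real.exp (-b * z i ^ 2) := by
  rw [← Real.exp_sum, Finset.mul_sum]

lemma gauss_integrable {d : ℕ} {b : ℝ} (hb : 0 < b) :
    Integrable (fun z : Fin d → ℝ => Real.exp (-b * ∑ i, z i ^ 2)) := by
  simp_rw [gauss_eq_prod]
  exact Integrable.fintype_prod (f := fun _ : Fin d => fun x : ℝ => Real.exp (-b * x ^ 2))
    (fun _ => integrable_exp_neg_mul_sq hb)

lemma gauss_integral {d : ℕ} (b : ℝ) :
    ∫ z : Fin d → ℝ, Real.exp (-b * ∑ i, z i ^ 2) = Real.sqrt (Real.pi / b) ^ d := by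
  simp_rw [gauss_eq_prod]
  rw [integral_fintype_prod_volume_eq_prod (fun _ : Fin d => fun x : ℝ => Real.exp (-b * x ^ 2))]
  simp only [integral_gaussian, Finset.prod_const, Finset.card_univ, Fintype.card_fin]

lemma heatK_eq (d : ℕ) (t : ℝ) (z : Fin d → ℝ) :
    heatK d t z = (4 * Real.pi * t) ^ (-(d : ℝ) / 2) *
      Real.exp (-(1 / (4 * t)) * ∑ i, z i ^ 2) := by
  unfold heatK; congr 2; ring

lemma heatK_integrable (d : ℕ) {t : ℝ} (ht : 0 < t) : Integrable (heatK d t) := by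
  have : heatK d t = fun z => (4 * Real.pi * t) ^ (-(d : ℝ) / 2) *
      Real.exp (-(1 / (4 * t)) * ∑ i, z i ^ 2) := funext (heatK_eq d t)
  rw [this]
  exact (gauss_integrable (by positivity)).const_mul _

lemma heatK_meas (d : ℕ) (t : ℝ) : Measurable (heatK d t) := by
  unfold heatK; fun_prop

lemma heatK_neg (d : ℕ) (t : ℝ) (z : Fin d → ℝ) : heatK d t (-z) = heatK d t z := by
  simp [heatK]

lemma rpow_sqrt (d : ℕ) {x : ℝ} (hx : 0 < x) : x ^ (-(d : ℝ) / 2) = (Real.sqrt x ^ d)⁻¹ := by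
  rw [Real.sqrt_eq_rpow, ← Real.rpow_natCast, ← Real.rpow_mul hx.le, ← Real.rpow_neg hx.le]
  congr 1; ring

lemma heatK_semigroup (d : ℕ) {t : ℝ} (ht : 0 < t) (p : Fin d → ℝ) :
    ∫ y, heatK d t y * heatK d t (p - y) = heatK d (2 * t) p := by
  have h1 : ∀ y : Fin d → ℝ, heatK d t y * heatK d t (p - y) =
      ((4 * Real.pi * t) ^ (-(d : ℝ) / 2) * (4 * Real.pi * t) ^ (-(d : ℝ) / 2) *
        Real.exp (-(∑ i, p i ^ 2) / (4 * (2 * t)))) *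
      Real.exp (-(1 / (2 * t)) * ∑ i, (y - (2⁻¹ : ℝ) • p) i ^ 2) := by
    intro y
    have : Real.exp (-(1 / (4 * t)) * ∑ i, y i ^ 2) *
        Real.exp (-(1 / (4 * t)) * ∑ i, (p - y) i ^ 2) =
        Real.exp (-(∑ i, p i ^ 2) / (4 * (2 * t))) *
        Real.exp (-(1 / (2 * t)) * ∑ i, (y - (2⁻¹ : ℝ) • p) i ^ 2) := by
      rw [← Real.exp_add, ← Real.exp_add]
      congr 1
      rw [show -(∑ i, p i ^ 2) / (4 * (2 * t)) = -(1 / (4 * (2 * t))) * ∑ i, p i ^ 2 by ring]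
      simp only [Finset.mul_sum, ← Finset.sum_add_distrib]
      refine Finset.sum_congr rfl fun i _ => ?_
      simp only [Pi.sub_apply, Pi.smul_apply, smul_eq_mul]
      field_simp
      ring
    rw [heatK_eq, heatK_eq, mul_mul_mul_comm, this, mul_assoc, mul_assoc]
    ring
  simp_rw [h1]
  rw [integral_const_mul,
    integral_sub_right_eq_self (fun y : Fin d → ℝ => Real.exp (-(1 / (2 * t)) * ∑ i, y i ^ 2)),
    gauss_integral, heatK, rpow_sqrt d (by positivity), rpow_sqrt d (by positivity)]
  have e : Real.sqrt (4 * Real.pi * (2 * t)) * Real.sqrt (Real.pi / (1 / (2 * t))) =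
      Real.sqrt (4 * Real.pi * t) * Real.sqrt (4 * Real.pi * t) := by
    rw [← Real.sqrt_mul (by positivity), ← Real.sqrt_mul (by positivity)]
    congr 1; field_simp; ring
  have e2 := congrArg (· ^ d) e
  simp only [mul_pow] at e2
  have p1 : 0 < Real.sqrt (4 * Real.pi * t) ^ d := by positivity
  have p2 : 0 < Real.sqrt (4 * Real.pi * (2 * t)) ^ d := by positivity
  generalize Real.sqrt (Real.pi / (1 / (2 * t))) ^ d = r at e2 ⊢
  generalize Real.sqrt (4 * Real.pi * t) ^ d = A at e2 p1 ⊢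
  generalize Real.sqrt (4 * Real.pi * (2 * t)) ^ d = B at e2 p2 ⊢
  field_simp
  rw [sq, ← e2]; ring

lemma heatK_scale (d : ℕ) {g h : ℝ} (hg : 0 < g) (hh : 0 < h) (z : Fin d → ℝ) :
    h ^ (-(d : ℝ) / 2) * heatK d g ((Real.sqrt h)⁻¹ • z) = heatK d (g * h) z := by
  have hs : (Real.sqrt h)⁻¹ ^ 2 = h⁻¹ := by rw [inv_pow, Real.sq_sqrt hh.le]
  unfold heatK
  rw [← mul_assoc, ← Real.mul_rpow (by positivity) (by positivity)]
  congr 2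
  · ring
  · simp only [Pi.smul_apply, smul_eq_mul, mul_pow, hs, ← Finset.mul_sum]
    field_simp

lemma integ_conv {d : ℕ} {K u : (Fin d → ℝ) → ℝ} (hK : Integrable K) (hu : BMP u)
    (x : Fin d → ℝ) : Integrable (fun z => K z * u (x - z)) := by
  obtain ⟨C, _, hC⟩ := hu.bdd
  refine hK.mul_bdd (c := C) ?_ (ae_of_all _ fun z => by simpa using hC _)
  exact (hu.meas.comp (by fun_prop)).aestronglyMeasurable

lemma conv_BMP {d : ℕ} {K u : (Fin d → ℝ) → ℝ} (hK : Integrable K) (hKm : Measurable K)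
    (hu : BMP u) : BMP (conv K u) := by
  refine ⟨?_, ?_, ?_⟩
  · have hm : Measurable (fun p : (Fin d → ℝ) × (Fin d → ℝ) => K p.2 * u (p.1 - p.2)) :=
      (hKm.comp measurable_snd).mul (hu.meas.comp (by fun_prop))
    exact hm.stronglyMeasurable.integral_prod_right.measurable
  · obtain ⟨C, hC0, hC⟩ := hu.bdd
    refine ⟨∫ z, |K z| * C, integral_nonneg fun z => by positivity, fun x => ?_⟩
    refine (abs_integral_le_integral_abs (f := fun z => K z * u (x - z))).trans ?_
    refine integral_mono (integ_conv hK hu x).abs (hK.abs.mul_const C) fun z => ?_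
    simp only [abs_mul]
    exact mul_le_mul_of_nonneg_left (hC _) (abs_nonneg _)
  · intro x k
    unfold conv
    congr 1; funext z
    rw [add_sub_right_comm, hu.per]

lemma unitBox_meas (d : ℕ) : MeasurableSet (unitBox d) :=
  MeasurableSet.univ_pi fun _ => measurableSet_Ico

lemma unitBox_vol (d : ℕ) : volume (unitBox d) = 1 := by
  simp [unitBox, volume_pi_pi]

instance unitBox_fin (d : ℕ) :
    IsFiniteMeasure ((volume : Measure (Fin d → ℝ)).restrict (unitBox d)) :=
  ⟨by rw [Measure.restrict_apply_univ, unitBox_vol]; simp⟩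

open scoped Pointwise in
lemma integral_box_shift {d : ℕ} {f : (Fin d → ℝ) → ℝ} (hf : ZPeriodic f) (z : Fin d → ℝ) :
    ∫ x in unitBox d, f (x + z) = ∫ x in unitBox d, f x := by
  have hfd := ZSpan.isAddFundamentalDomain' (Pi.basisFun ℝ (Fin d)) volume
  rw [ZSpan.fundamentalDomain_pi_basisFun] at hfd
  change IsAddFundamentalDomain _ (unitBox d) _ at hfd
  have h2 := hfd.vadd_of_comm z
  have h3 : ∀ (g : (Submodule.span ℤ (Set.range (Pi.basisFun ℝ (Fin d)))).toAddSubgroup)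
      (x : Fin d → ℝ), f (g +ᵥ x) = f x := by
    rintro ⟨g, hg⟩ x
    have hg' : g ∈ Submodule.span ℤ (Set.range (Pi.basisFun ℝ (Fin d))) := hg
    rw [Module.Basis.mem_span_iff_repr_mem] at hg'
    choose k hk using hg'
    have : g = fun i => (k i : ℝ) := by
      funext i; simpa using (hk i).symm
    change f (g + x) = f x
    rw [this, add_comm, hf]
  have hc : Countable (Submodule.span ℤ (Set.range (Pi.basisFun ℝ (Fin d)))).toAddSubgroup :=
    inferInstanceAs (Countable (Submodule.span ℤ (Set.range (Pi.basisFun ℝ (Fin d)))))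
  have h4 := hfd.setIntegral_eq h2 (f := f) h3
  rw [h4]
  have mp := measurePreserving_add_left (volume : Measure (Fin d → ℝ)) z
  have := mp.setIntegral_preimage_emb (measurableEmbedding_addLeft z) f (z +ᵥ unitBox d)
  rw [← this]
  have hs : (fun x => z + x) ⁻¹' (z +ᵥ unitBox d) = unitBox d := by
    ext x; simp [Set.mem_vadd_set]
  rw [hs]
  simp_rw [add_comm]

lemma conv_selfadj {d : ℕ} {K u v : (Fin d → ℝ) → ℝ} (hK : Integrable K) (hKm : Measurable K)
    (hKe : ∀ z, K (-z) = K z) (hu : BMP u) (hv : BMP v) :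
    ∫ x in unitBox d, u x * conv K v x = ∫ x in unitBox d, conv K u x * v x := by
  obtain ⟨C, hC0, hC⟩ := hu.bdd
  obtain ⟨D, hD0, hD⟩ := hv.bdd
  have num := hu.meas
  have nvm := hv.meas
  have base : Integrable (fun p : (Fin d → ℝ) × (Fin d → ℝ) => (1 : ℝ) * K p.2)
      ((volume.restrict (unitBox d)).prod volume) :=
    (integrable_const (1 : ℝ)).mul_prod hK
  have I1 : Integrable (fun p : (Fin d → ℝ) × (Fin d → ℝ) => K p.2 * (u p.1 * v (p.1 - p.2)))
      ((volume.restrict (unitBox d)).prod volume) := by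
    simp only [one_mul] at base
    refine base.mul_bdd (c := C * D) ?_ (ae_of_all _ fun p => ?_)
    · exact ((num.comp measurable_fst).mul (nvm.comp (by fun_prop))).aestronglyMeasurable
    · rw [norm_mul]; exact mul_le_mul (hC _) (hD _) (norm_nonneg _) hC0
  have I2 : Integrable (fun p : (Fin d → ℝ) × (Fin d → ℝ) => K p.2 * (u (p.1 - p.2) * v p.1))
      ((volume.restrict (unitBox d)).prod volume) := by
    simp only [one_mul] at base
    refine base.mul_bdd (c := C * D) ?_ (ae_of_all _ fun p => ?_)
    · exact ((num.comp (by fun_prop)).mul (nvm.comp measurable_fst)).aestronglyMeasurable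
    · rw [norm_mul]; exact mul_le_mul (hC _) (hD _) (norm_nonneg _) hC0
  have L : ∫ x in unitBox d, u x * conv K v x =
      ∫ z, K z * ∫ x in unitBox d, u x * v (x - z) := by
    calc _ = ∫ x in unitBox d, ∫ z, K z * (u x * v (x - z)) := by
          congr 1; funext x; unfold conv; rw [← integral_const_mul]; congr 1; funext z; ring
      _ = ∫ z, ∫ x in unitBox d, K z * (u x * v (x - z)) := integral_integral_swap I1
      _ = _ := by simp_rw [integral_const_mul]
  have R : ∫ x in unitBox d, conv K u x * v x =
      ∫ z, K z * ∫ x in unitBox d, u (x - z) * v x := by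
    calc _ = ∫ x in unitBox d, ∫ z, K z * (u (x - z) * v x) := by
          congr 1; funext x; unfold conv; rw [← integral_mul_const]; congr 1; funext z; ring
      _ = ∫ z, ∫ x in unitBox d, K z * (u (x - z) * v x) := integral_integral_swap I2
      _ = _ := by simp_rw [integral_const_mul]
  rw [L, R, ← integral_neg_eq_self]
  congr 1; funext z
  rw [hKe]
  congr 1
  have hp : ZPeriodic (fun x => u (x - z) * v x) := by
    intro x k
    simp only
    rw [add_sub_right_comm, hu.per, hv.per]
  rw [← integral_box_shift hp z]
  congr 1; funext x
  simp

lemma conv_conv {d : ℕ} {t : ℝ} (ht : 0 < t) {v : (Fin d → ℝ) → ℝ} (hv : BMP v) :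
    conv (heatK d t) (conv (heatK d t) v) = conv (heatK d (2 * t)) v := by
  funext x
  obtain ⟨D, hD0, hD⟩ := hv.bdd
  have hK := heatK_integrable d ht
  have I0 := Integrable.convolution_integrand (μ := (volume : Measure (Fin d → ℝ)))
    (ν := (volume : Measure (Fin d → ℝ))) (ContinuousLinearMap.mul ℝ ℝ) hK hK
  simp only [ContinuousLinearMap.mul_apply'] at I0
  have I1 : Integrable (fun p : (Fin d → ℝ) × (Fin d → ℝ) =>
      heatK d t p.2 * heatK d t (p.1 - p.2) * v (x - p.1)) (volume.prod volume) := by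
    refine I0.mul_bdd (c := D) ?_ (ae_of_all _ fun p => hD _)
    exact (hv.meas.comp (by fun_prop)).aestronglyMeasurable
  calc conv (heatK d t) (conv (heatK d t) v) x
      = ∫ y, ∫ p, heatK d t y * heatK d t (p - y) * v (x - p) := by
        unfold conv
        congr 1; funext y
        rw [← integral_const_mul,
          ← integral_sub_right_eq_self (fun z => heatK d t y * (heatK d t z * v (x - y - z))) y]
        congr 1; funext p
        rw [mul_assoc]; congr 3; abel
    _ = ∫ p, ∫ y, heatK d t y * heatK d t (p - y) * v (x - p) := (integral_integral_swap I1).symm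
    _ = _ := by
        unfold conv
        congr 1; funext p
        rw [integral_mul_const, heatK_semigroup d ht]

lemma key {d : ℕ} {g h : ℝ} (hg : 0 < g) (hh : 0 < h) {u v : (Fin d → ℝ) → ℝ}
    (hu : BMP u) (hv : BMP v) :
    ∫ x in unitBox d, u x * conv (heatK d (g * h)) v x =
      ∫ x in unitBox d, conv (heatK d (g * (h / 2))) u x * conv (heatK d (g * (h / 2))) v x := by
  have ht : 0 < g * (h / 2) := by positivity
  have e : g * h = 2 * (g * (h / 2)) := by ring
  rw [e, ← conv_conv ht hv]
  exact conv_selfadj (heatK_integrable d ht) (heatK_meas d _) (heatK_neg d _) hu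
    (conv_BMP (heatK_integrable d ht) (heatK_meas d _) hv)

lemma BMP.mul_integrable {d : ℕ} {u v : (Fin d → ℝ) → ℝ} (hu : BMP u) (hv : BMP v) :
    Integrable (fun x => u x * v x) (volume.restrict (unitBox d)) := by
  obtain ⟨C, hC0, hC⟩ := hu.bdd
  obtain ⟨D, hD0, hD⟩ := hv.bdd
  refine Integrable.of_bound (hu.meas.mul hv.meas).aestronglyMeasurable (C * D)
    (ae_of_all _ fun x => ?_)
  rw [norm_mul]; exact mul_le_mul (hC _) (hD _) (norm_nonneg _) hC0

lemma conv_Khij {d : ℕ} {γ β h : ℝ} (hγ : 0 < γ) (hβ : 0 < β) (hh : 0 < h) (a b : ℝ)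
    {v : (Fin d → ℝ) → ℝ} (hv : BMP v) (x : Fin d → ℝ) :
    conv (Khij d γ β a b h) v x =
      a * conv (heatK d (γ * h)) v x + b * conv (heatK d (β * h)) v x := by
  unfold conv
  rw [← integral_const_mul, ← integral_const_mul, ← integral_add
    ((integ_conv (heatK_integrable d (by positivity)) hv x).const_mul _)
    ((integ_conv (heatK_integrable d (by positivity)) hv x).const_mul _)]
  congr 1; funext z
  rw [← heatK_scale d hγ hh, ← heatK_scale d hβ hh, Khij]
  ring

/-- the identity
`−2√h Σ_{i,j} ∫ w_i K^h_ij * w_j = 2√h ∫ |G_γ^{h/2}*w|²_𝔸 + |G_β^{h/2}*w|²_𝔹`. -/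
theorem stmt_4 (d N : ℕ) (γ β h : ℝ) (hβ0 : 0 < β) (hβγ : β < γ) (hh : 0 < h)
    (a b : Fin N → Fin N → ℝ)
    (hasymm : ∀ i j, a i j = a j i) (hbsymm : ∀ i j, b i j = b j i)
    (hadiag : ∀ i, a i i = 0) (hbdiag : ∀ i, b i i = 0)
    (w : (Fin d → ℝ) → Fin N → ℝ)
    (hwmeas : Measurable w) (hwper : ZPeriodic w)
    (hwbdd : ∃ C : ℝ, ∀ x i, |w x i| ≤ C) :
    -2 * Real.sqrt h * ∑ i, ∑ j, ∫ x in unitBox d,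
        w x i * conv (Khij d γ β (a i j) (b i j) h) (fun y => w y j) x
      = 2 * Real.sqrt h * ∫ x in unitBox d,
          ((∑ i, ∑ j, conv (heatK d (γ * (h / 2))) (fun y => w y i) x * (-(a i j)) *
              conv (heatK d (γ * (h / 2))) (fun y => w y j) x) +
           (∑ i, ∑ j, conv (heatK d (β * (h / 2))) (fun y => w y i) x * (-(b i j)) *
              conv (heatK d (β * (h / 2))) (fun y => w y j) x)) := by
  have hγ : 0 < γ := hβ0.trans hβγ
  obtain ⟨C, hC⟩ := hwbdd
  have hw : ∀ i, BMP (fun y => w y i) := fun i =>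
    ⟨(measurable_pi_apply i).comp hwmeas,
      ⟨|C|, abs_nonneg _, fun x => (hC x i).trans (le_abs_self C)⟩,
      fun x k => congrFun (hwper x k) i⟩
  have hA : ∀ g, 0 < g → ∀ i, BMP (conv (heatK d g) (fun y => w y i)) := fun g hg i =>
    conv_BMP (heatK_integrable d hg) (heatK_meas d g) (hw i)
  have hγ2 : 0 < γ * (h / 2) := by positivity
  have hβ2 : 0 < β * (h / 2) := by positivity
  have IG : ∀ g, 0 < g → ∀ (c : Fin N → Fin N → ℝ) i j, Integrable (fun x =>
      conv (heatK d g) (fun y => w y i) x * (-(c i j)) * conv (heatK d g) (fun y => w y j) x)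
      (volume.restrict (unitBox d)) := by
    intro g hg c i j
    refine (((hA g hg i).mul_integrable (hA g hg j)).const_mul (-(c i j))).congr
      (ae_of_all _ fun x => ?_)
    simp only
    ring
  have IS : ∀ g, 0 < g → ∀ (c : Fin N → Fin N → ℝ), ∫ x in unitBox d, (∑ i, ∑ j,
      conv (heatK d g) (fun y => w y i) x * (-(c i j)) * conv (heatK d g) (fun y => w y j) x) =
      ∑ i, ∑ j, -(c i j) * ∫ x in unitBox d,
        conv (heatK d g) (fun y => w y i) x * conv (heatK d g) (fun y => w y j) x := by
    intro g hg c
    rw [integral_finsetSum _ fun i _ => integrable_finsetSum _ fun j _ => IG g hg c i j]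
    refine Finset.sum_congr rfl fun i _ => ?_
    rw [integral_finsetSum _ fun j _ => IG g hg c i j]
    refine Finset.sum_congr rfl fun j _ => ?_
    rw [← integral_const_mul]
    congr 1; funext x; ring
  rw [integral_add
    (integrable_finsetSum _ fun i _ => integrable_finsetSum _ fun j _ => IG _ hγ2 a i j)
    (integrable_finsetSum _ fun i _ => integrable_finsetSum _ fun j _ => IG _ hβ2 b i j),
    IS _ hγ2 a, IS _ hβ2 b, ← Finset.sum_add_distrib, neg_mul, neg_mul, ← mul_neg,
    ← Finset.sum_neg_distrib]
  congr 1
  refine Finset.sum_congr rfl fun i _ => ?_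
  rw [← Finset.sum_add_distrib, ← Finset.sum_neg_distrib]
  refine Finset.sum_congr rfl fun j _ => ?_
  rw [← key hγ hh (hw i) (hw j), ← key hβ0 hh (hw i) (hw j), ← integral_const_mul,
    ← integral_const_mul, ← integral_add, ← integral_neg]
  · congr 1; funext x
    rw [conv_Khij hγ hβ0 hh _ _ (hw j)]
    ring
  · exact ((hw i).mul_integrable (hA _ (by positivity) j)).const_mul _
  · exact ((hw i).mul_integrable (hA _ (by positivity) j)).const_mul _
end

section
/- Let d ≥ 1, γ > β > 0, a, b ∈ ℝ, and set K(z) = a·G_γ(z) + b·G_β(z). Let μ ≠ 0 satisfy 1/μ = a/(√π·√γ) + b/(√π·√β). Then for every ξ ∈ ℝ^d and every unit vector ν ∈ ℝ^d: ∫_{ℝ^d} ξ·(∇²K(z))ξ · (ν·z)₊ dz = (1/(2μ))·(ξ·ν)², where ∇²K denotes the Hessian matrix of K and (·)₊ denotes the positive part. -/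
open Real MeasureTheory
open scoped RealInnerProductSpace

/-- The `d`-dimensional heat kernel `G_t(z) = (4πt)^{-d/2} exp(-|z|²/(4t))`. -/
noncomputable def heatKE (d : ℕ) (t : ℝ) (z : EuclideanSpace ℝ (Fin d)) : ℝ :=
  (4 * Real.pi * t) ^ (-(d : ℝ) / 2) * Real.exp (-‖z‖ ^ 2 / (4 * t))

section helpers

variable {n : ℕ}

local notation "EE" => EuclideanSpace ℝ (Fin (n + 1))

lemma aux_int_norm (κ : ℝ) (hκ : 0 < κ) (m : ℕ) :
    Integrable (fun z : EE => ‖z‖ ^ m * Real.exp (-κ * ‖z‖ ^ 2)) := by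
  have h := (integrable_fun_norm_addHaar (E := EE) (volume : Measure EE)
    (f := fun r : ℝ => r ^ m * Real.exp (-κ * r ^ 2))).2
  apply h
  have h2 := (integrable_rpow_mul_exp_neg_mul_sq hκ
    (s := (((Module.finrank ℝ EE - 1 + m : ℕ) : ℝ))) (by
      have : (0 : ℝ) ≤ ((Module.finrank ℝ EE - 1 + m : ℕ) : ℝ) := Nat.cast_nonneg _
      linarith)).integrableOn (s := Set.Ioi 0)
  refine h2.congr_fun (fun x hx => ?_) measurableSet_Ioi
  simp only [Real.rpow_natCast, smul_eq_mul]
  rw [pow_add]; ring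

lemma aux_int (κ : ℝ) (hκ : 0 < κ) (m : ℕ) (C : ℝ) (f : EE → ℝ) (hf : Continuous f)
    (hb : ∀ z, |f z| ≤ C * ‖z‖ ^ m) :
    Integrable (fun z : EE => f z * Real.exp (-κ * ‖z‖ ^ 2)) := by
  refine ((aux_int_norm κ hκ m).const_mul C).mono' (by fun_prop) (Filter.Eventually.of_forall ?_)
  intro z
  rw [Real.norm_eq_abs, abs_mul, abs_of_pos (Real.exp_pos _), ← mul_assoc]
  exact mul_le_mul_of_nonneg_right (hb z) (Real.exp_pos _).le

lemma aux_max (ν z : EE) : |max ⟪ν, z⟫ 0| ≤ ‖ν‖ * ‖z‖ := by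
  rw [abs_of_nonneg (le_max_right _ _)]
  exact max_le (real_inner_le_norm _ _) (by positivity)

lemma aux_hd1 (κ : ℝ) (z w : EE) :
    HasFDerivAt (fun x : EE => Real.exp (-κ * ‖x‖ ^ 2))
      ((-2 * κ * Real.exp (-κ * ‖z‖ ^ 2)) • innerSL ℝ z) z := by
  have h := ((hasStrictFDerivAt_norm_sq z).hasFDerivAt.const_mul (-κ)).exp
  have e : (-2 * κ * Real.exp (-κ * ‖z‖ ^ 2)) • innerSL ℝ z
      = Real.exp (-κ * ‖z‖ ^ 2) • -κ • (2 : ℕ) • innerSL ℝ z := by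
    module
  rw [e]
  exact h

lemma aux_hd2 (κ : ℝ) (z w : EE) :
    HasFDerivAt (fun x : EE => -2 * κ * (⟪w, x⟫ * Real.exp (-κ * ‖x‖ ^ 2)))
      ((-2 * κ) • (⟪w, z⟫ • ((-2 * κ * Real.exp (-κ * ‖z‖ ^ 2)) • innerSL ℝ z)
        + Real.exp (-κ * ‖z‖ ^ 2) • innerSL ℝ w)) z :=
  (((innerSL ℝ w).hasFDerivAt (x := z)).mul (aux_hd1 κ z w)).const_mul (-2 * κ)

lemma aux_1d (κ : ℝ) (hκ : 0 < κ) :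
    ∫ x : ℝ, (4 * κ ^ 2 * x ^ 2 - 2 * κ) * max x 0 * Real.exp (-κ * x ^ 2) = 1 := by
  have e : ∫ x : ℝ, (4 * κ ^ 2 * x ^ 2 - 2 * κ) * max x 0 * Real.exp (-κ * x ^ 2)
      = ∫ x in Set.Ioi (0 : ℝ), (4 * κ ^ 2 * x ^ 3 - 2 * κ * x) * Real.exp (-κ * x ^ 2) := by
    rw [← integral_indicator measurableSet_Ioi]
    congr 1
    ext x
    by_cases hx : 0 < x
    · rw [Set.indicator_of_mem (by exact hx), max_eq_left hx.le]; ring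
    · rw [Set.indicator_of_notMem (by exact hx), max_eq_right (not_lt.1 hx)]; ring
  rw [e]
  have hint : IntegrableOn (fun x : ℝ => (4 * κ ^ 2 * x ^ 3 - 2 * κ * x) * Real.exp (-κ * x ^ 2))
      (Set.Ioi 0) := by
    have h3 := (integrable_rpow_mul_exp_neg_mul_sq hκ (s := 3) (by norm_num)).const_mul (4 * κ ^ 2)
    have h1 := (integrable_rpow_mul_exp_neg_mul_sq hκ (s := 1) (by norm_num)).const_mul (2 * κ)
    refine ((h3.sub h1).integrableOn).congr_fun (fun x hx => ?_) measurableSet_Ioi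
    have : x ^ (3 : ℝ) = x ^ 3 := by exact_mod_cast Real.rpow_natCast x 3
    simp only [Pi.sub_apply, Real.rpow_one, this]
    ring
  have hlim : Filter.Tendsto (fun x : ℝ => -(2 * κ * x ^ 2 + 1) * Real.exp (-κ * x ^ 2))
      Filter.atTop (nhds 0) := by
    have hs : Filter.Tendsto (fun x : ℝ => κ * x ^ 2) Filter.atTop Filter.atTop :=
      (Filter.tendsto_pow_atTop (by norm_num)).const_mul_atTop hκ
    have h1 := (Real.tendsto_pow_mul_exp_neg_atTop_nhds_zero 1).comp hs
    have h0 := (Real.tendsto_pow_mul_exp_neg_atTop_nhds_zero 0).comp hs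
    have := ((h1.const_mul 2).add h0).neg
    simp only [mul_zero, add_zero, neg_zero] at this
    refine this.congr (fun x => ?_)
    simp only [Function.comp, pow_one, pow_zero, neg_mul]
    ring
  rw [integral_Ioi_of_hasDerivAt_of_tendsto' (m := 0)
    (f := fun x : ℝ => -(2 * κ * x ^ 2 + 1) * Real.exp (-κ * x ^ 2)) ?_ hint hlim]
  · simp
  · intro x _
    have hp : HasDerivAt (fun x : ℝ => x ^ 2) (2 * x) x := by simpa using hasDerivAt_pow 2 x
    have hh := (((hp.const_mul (2 * κ)).add_const 1).neg).mul ((hp.const_mul (-κ)).exp)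
    refine hh.congr_deriv ?_
    simp only [Pi.neg_apply]
    ring

lemma aux_prod (κ : ℝ) (ν : EE) (hν : ‖ν‖ = 1) (φ : ℝ → ℝ) :
    ∫ z : EE, φ ⟪ν, z⟫ * Real.exp (-κ * ‖z‖ ^ 2)
      = (∫ x : ℝ, φ x * Real.exp (-κ * x ^ 2)) * √(π / κ) ^ n := by
  obtain ⟨b, hb⟩ := Orthonormal.exists_orthonormalBasis_extension_of_card_eq (𝕜 := ℝ) (E := EE)
    (ι := Fin (n + 1)) (by simp) (v := fun _ => ν) (s := {0}) (by
      constructor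
      · intro i; simpa using hν
      · intro i j hij
        exact absurd (Subsingleton.elim i j) hij)
  have hb0 : b 0 = ν := hb 0 rfl
  have hm := ((PiLp.volume_preserving_ofLp (Fin (n + 1))).comp b.measurePreserving_repr)
  set F : Fin (n + 1) → ℝ → ℝ :=
    Fin.cons (fun x => φ x * Real.exp (-κ * x ^ 2)) (fun _ x => Real.exp (-κ * x ^ 2)) with hF
  have hemb : MeasurableEmbedding (WithLp.ofLp ∘ b.repr : EE → (Fin (n + 1) → ℝ)) :=
    ((MeasurableEquiv.toLp 2 (Fin (n + 1) → ℝ)).symm.measurableEmbedding).comp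
      b.measurableEquiv.measurableEmbedding
  have h1 := hm.integral_comp hemb (fun y : Fin (n + 1) → ℝ => ∏ i, F i (y i))
  rw [integral_fintype_prod_volume_eq_prod, Fin.prod_univ_succ] at h1
  simp only [hF, Fin.cons_zero, Fin.cons_succ, integral_gaussian, Finset.prod_const,
    Finset.card_univ, Fintype.card_fin] at h1
  rw [← h1]
  congr 1
  ext z
  rw [Fin.prod_univ_succ]
  simp only [Fin.cons_zero, Fin.cons_succ, Function.comp, OrthonormalBasis.repr_apply_apply, hb0]
  rw [mul_assoc, ← Real.exp_sum, ← Real.exp_add, ← b.sum_sq_norm_inner_right z, Fin.sum_univ_succ,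
    hb0, mul_add, Finset.mul_sum]
  simp

/-- Second directional derivative of the Gaussian. -/
noncomputable def auxH (κ : ℝ) (w v z : EuclideanSpace ℝ (Fin (n + 1))) : ℝ :=
  (4 * κ ^ 2 * (⟪w, z⟫ * ⟪v, z⟫) - 2 * κ * ⟪w, v⟫) * Real.exp (-κ * ‖z‖ ^ 2)

lemma aux_H_int (κ : ℝ) (hκ : 0 < κ) (w v ν : EE) :
    Integrable (fun z : EE => auxH κ w v z * max ⟪ν, z⟫ 0) := by
  have h1 := (aux_int κ hκ 3 (‖w‖ * ‖v‖ * ‖ν‖) (fun z : EE => ⟪w, z⟫ * ⟪v, z⟫ * max ⟪ν, z⟫ 0)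
    (by fun_prop) (fun z => by
      rw [abs_mul, abs_mul]
      calc _ ≤ (‖w‖ * ‖z‖) * (‖v‖ * ‖z‖) * (‖ν‖ * ‖z‖) := by
            gcongr
            · exact abs_real_inner_le_norm _ _
            · exact abs_real_inner_le_norm _ _
            · exact aux_max _ _
        _ = _ := by ring)).const_mul (4 * κ ^ 2)
  have h2 := (aux_int κ hκ 1 ‖ν‖ (fun z : EE => max ⟪ν, z⟫ 0)
    (by fun_prop) (fun z => by simpa using aux_max ν z)).const_mul (2 * κ * ⟪w, v⟫)
  refine (h1.sub h2).congr (Filter.Eventually.of_forall fun z => ?_)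
  simp only [Pi.sub_apply, auxH]
  ring

lemma aux_H_perp (κ : ℝ) (hκ : 0 < κ) (w v ν : EE) (hv : ⟪ν, v⟫ = 0) :
    ∫ z : EE, auxH κ w v z * max ⟪ν, z⟫ 0 = 0 := by
  have key := integral_bilinear_hasLineDerivAt_right_eq_neg_left_of_integrable
    (μ := (volume : Measure EE)) (B := ContinuousLinearMap.mul ℝ ℝ) (v := v)
    (f := fun z : EE => max ⟪ν, z⟫ 0) (f' := fun _ => 0)
    (g := fun x : EE => -2 * κ * (⟪w, x⟫ * Real.exp (-κ * ‖x‖ ^ 2)))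
    (g' := fun z => auxH κ w v z) (by simp)
    (by
      refine (aux_H_int κ hκ w v ν).congr (Filter.Eventually.of_forall fun z => ?_)
      simp [mul_comm])
    (by
      have h1 := (aux_int κ hκ 2 (‖w‖ * ‖ν‖) (fun z : EE => ⟪w, z⟫ * max ⟪ν, z⟫ 0)
        (by fun_prop) (fun z => by
          rw [abs_mul]
          calc _ ≤ (‖w‖ * ‖z‖) * (‖ν‖ * ‖z‖) := by
                gcongr
                · exact abs_real_inner_le_norm _ _
                · exact aux_max _ _
            _ = _ := by ring)).const_mul (-2 * κ)
      refine h1.congr (Filter.Eventually.of_forall fun z => ?_)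
      simp only [ContinuousLinearMap.mul_apply']
      ring)
    (by
      intro x _
      unfold HasLineDerivAt
      simp only [inner_add_right, inner_smul_right, hv, mul_zero, add_zero]
      exact hasDerivAt_const _ _)
    (by
      intro x _
      convert (aux_hd2 κ x w).hasLineDerivAt v using 1
      simp [auxH, real_inner_comm]
      ring)
  simp only [ContinuousLinearMap.mul_apply', zero_mul, integral_zero, neg_zero] at key
  refine Eq.trans (integral_congr_ae (Filter.Eventually.of_forall fun z => ?_)) key
  exact mul_comm _ _

lemma aux_H_main (κ : ℝ) (hκ : 0 < κ) (ξ ν : EE) (hν : ‖ν‖ = 1) :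
    ∫ z : EE, auxH κ ξ ξ z * max ⟪ν, z⟫ 0 = ⟪ξ, ν⟫ ^ 2 * √(π / κ) ^ n := by
  have hνν : ⟪ν, ν⟫ = 1 := by rw [real_inner_self_eq_norm_sq, hν]; norm_num
  set c := ⟪ξ, ν⟫ with hc
  set η := ξ - c • ν with hη
  have hp : ⟪ν, η⟫ = 0 := by
    rw [hη, inner_sub_right, inner_smul_right, hνν, real_inner_comm, ← hc]; ring
  have hξ : ξ = c • ν + η := by rw [hη]; abel
  have e : ∀ z : EE, auxH κ ξ ξ z * max ⟪ν, z⟫ 0 = c ^ 2 * (auxH κ ν ν z * max ⟪ν, z⟫ 0)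
      + c * (auxH κ ν η z * max ⟪ν, z⟫ 0) + auxH κ ξ η z * max ⟪ν, z⟫ 0 := by
    intro z
    have e1 : ⟪ξ, z⟫ = c * ⟪ν, z⟫ + ⟪η, z⟫ := by
      conv_lhs => rw [hξ]
      rw [inner_add_left, real_inner_smul_left]
    have e2 : ⟪ξ, η⟫ = ⟪η, η⟫ := by
      conv_lhs => rw [hξ]
      rw [inner_add_left, real_inner_smul_left, hp]; ring
    have e3 : ⟪ξ, ξ⟫ = c ^ 2 + ⟪η, η⟫ := by
      conv_lhs => rw [hξ]
      rw [inner_add_left, inner_add_right, inner_add_right, real_inner_smul_left,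
        real_inner_smul_left, real_inner_smul_right, real_inner_smul_right, hνν, real_inner_comm ν η, hp]
      ring
    simp only [auxH, e3, e2, e1, hp, hνν]
    ring
  simp_rw [e]
  have i1 := (aux_H_int κ hκ ν ν ν).const_mul (c ^ 2)
  have i2 := (aux_H_int κ hκ ν η ν).const_mul c
  have i3 := aux_H_int κ hκ ξ η ν
  rw [integral_add (f := fun z => c ^ 2 * (auxH κ ν ν z * max ⟪ν, z⟫ 0)
      + c * (auxH κ ν η z * max ⟪ν, z⟫ 0)) (i1.add i2) i3, integral_add i1 i2, integral_const_mul, integral_const_mul,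
    aux_H_perp κ hκ _ _ _ hp, aux_H_perp κ hκ _ _ _ hp]
  have := aux_prod κ ν hν (fun x => (4 * κ ^ 2 * x ^ 2 - 2 * κ) * max x 0)
  rw [aux_1d κ hκ, one_mul] at this
  rw [← this, mul_zero, add_zero, add_zero]
  congr 2
  ext z
  simp only [auxH, hνν]
  ring

lemma aux_heat (t : ℝ) :
    heatKE (n + 1) t = fun z => (4 * Real.pi * t) ^ (-((n + 1 : ℕ) : ℝ) / 2) *
      Real.exp (-(1 / (4 * t)) * ‖z‖ ^ 2) := by
  ext z
  unfold heatKE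
  congr 2
  ring

lemma aux_const (t : ℝ) (ht : 0 < t) :
    (4 * Real.pi * t) ^ (-((n + 1 : ℕ) : ℝ) / 2) * √(π / (1 / (4 * t))) ^ n
      = 1 / (2 * (√π * √t)) := by
  have hpos : 0 < 4 * π * t := by positivity
  have e : π / (1 / (4 * t)) = 4 * π * t := by field_simp
  have e4 : √(4 * π * t) = 2 * (√π * √t) := by
    rw [mul_assoc, Real.sqrt_mul (by norm_num), Real.sqrt_mul pi_pos.le]
    congr 1
    rw [show (4 : ℝ) = 2 ^ 2 by norm_num, Real.sqrt_sq (by norm_num)]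
  rw [e, ← e4, Real.sqrt_eq_rpow, ← Real.rpow_natCast, ← Real.rpow_mul hpos.le,
    ← Real.rpow_add hpos, one_div ((4 * π * t) ^ _), ← Real.rpow_neg hpos.le]
  congr 1
  push_cast
  ring

end helpers

/-- if `1/μ = a/(√π√γ) + b/(√π√β)` and `K = a G_γ + b G_β`, then
`∫ ξ·(∇²K(z))ξ·(ν·z)₊ dz = (1/(2μ))·(ξ·ν)²` for every `ξ` and every unit vector `ν`. -/
theorem stmt_15 (d : ℕ) (hd : 1 ≤ d) (γ β : ℝ) (hβ0 : 0 < β) (hβγ : β < γ)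
    (a b μ : ℝ) (hμ : μ ≠ 0)
    (hμab : 1 / μ = a / (Real.sqrt Real.pi * Real.sqrt γ) +
      b / (Real.sqrt Real.pi * Real.sqrt β)) :
    ∀ (ξ ν : EuclideanSpace ℝ (Fin d)), ‖ν‖ = 1 →
      ∫ z : EuclideanSpace ℝ (Fin d),
          (fderiv ℝ
              (fun y => fderiv ℝ (fun x => a * heatKE d γ x + b * heatKE d β x) y ξ) z) ξ *
            max ⟪ν, z⟫ 0
        = 1 / (2 * μ) * ⟪ξ, ν⟫ ^ 2 := by
  intro ξ ν hν
  obtain ⟨n, rfl⟩ : ∃ n, d = n + 1 := ⟨d - 1, by omega⟩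
  have hγ0 : 0 < γ := hβ0.trans hβγ
  set κ := 1 / (4 * γ) with hκ
  set l := 1 / (4 * β) with hl
  have hκ0 : 0 < κ := by positivity
  have hl0 : 0 < l := by positivity
  set A := a * (4 * Real.pi * γ) ^ (-((n + 1 : ℕ) : ℝ) / 2) with hA
  set B := b * (4 * Real.pi * β) ^ (-((n + 1 : ℕ) : ℝ) / 2) with hB
  have hK : (fun x => a * heatKE (n + 1) γ x + b * heatKE (n + 1) β x) =
      fun x => A * Real.exp (-κ * ‖x‖ ^ 2) + B * Real.exp (-l * ‖x‖ ^ 2) := by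
    ext x
    rw [aux_heat, aux_heat]
    simp only [hA, hB, hκ, hl]
    ring
  have h1 : (fun y => fderiv ℝ (fun x => a * heatKE (n + 1) γ x + b * heatKE (n + 1) β x) y ξ) =
      fun y => A * (-2 * κ * (⟪ξ, y⟫ * Real.exp (-κ * ‖y‖ ^ 2)))
        + B * (-2 * l * (⟪ξ, y⟫ * Real.exp (-l * ‖y‖ ^ 2))) := by
    ext y
    rw [hK, (((aux_hd1 κ y ξ).const_mul A).fun_add ((aux_hd1 l y ξ).const_mul B)).fderiv]
    simp [real_inner_comm]
    ring
  have h2 : ∀ z, (fderiv ℝ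
      (fun y => fderiv ℝ (fun x => a * heatKE (n + 1) γ x + b * heatKE (n + 1) β x) y ξ) z) ξ *
        max ⟪ν, z⟫ 0 = A * (auxH κ ξ ξ z * max ⟪ν, z⟫ 0) + B * (auxH l ξ ξ z * max ⟪ν, z⟫ 0) := by
    intro z
    rw [h1, (((aux_hd2 κ z ξ).const_mul A).fun_add ((aux_hd2 l z ξ).const_mul B)).fderiv]
    rw [← mul_assoc, ← mul_assoc, ← add_mul]
    congr 1
    simp only [auxH, ContinuousLinearMap.add_apply, ContinuousLinearMap.smul_apply,
      innerSL_apply_apply, smul_eq_mul, real_inner_comm z ξ]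
    ring
  simp_rw [h2]
  rw [integral_add ((aux_H_int κ hκ0 ξ ξ ν).const_mul A) ((aux_H_int l hl0 ξ ξ ν).const_mul B),
    integral_const_mul, integral_const_mul, aux_H_main κ hκ0 ξ ν hν, aux_H_main l hl0 ξ ν hν]
  have cγ := aux_const (n := n) γ hγ0
  have cβ := aux_const (n := n) β hβ0
  rw [← hκ] at cγ
  rw [← hl] at cβ
  have e : 1 / (2 * μ) = 1 / 2 * (1 / μ) := by rw [one_div_mul_one_div]
  rw [e, hμab]
  calc _ = ⟪ξ, ν⟫ ^ 2 * (a * ((4 * Real.pi * γ) ^ (-((n + 1 : ℕ) : ℝ) / 2) * √(π / κ) ^ n)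
        + b * ((4 * Real.pi * β) ^ (-((n + 1 : ℕ) : ℝ) / 2) * √(π / l) ^ n)) := by
        rw [hA, hB]; ring
    _ = _ := by rw [cγ, cβ]; ring
end
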